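/- arXiv:2107.10706 — 9 statements merged into one kernel-verified Lean document; each statement's English description precedes it below -/
import Mathlib

section
/- Let d ≥ 1 be an integer, α > 0, and let q = ((2+α) − √(α² + 4α))/2 be the smaller root of q² − (2+α)q + 1 = 0. Let T ∈ ℝ^{d×d} be the tridiagonal matrix with T₁₁ = 1+α, T_{ii} = 2+α for 2 ≤ i ≤ d, T_{i,i+1} = T_{i+1,i} = −1 for 1 ≤ i ≤ d−1, and all other entries zero. Then T is positive definite, and the unique solution y* of T y = e₁ (where e₁ is the first standard basis vector) satisfies ‖ȳ − y*‖ ≤ q^{d+1}/(α(1−q)), where ȳ ∈ ℝ^d is the vector with coordinates ȳ_i = q^i/(1−q) for i = 1,…,d. -/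
/-- Entry `(i, j)` of the tridiagonal matrix, indexed by natural numbers. -/
def tridiagEntry (α : ℝ) (i j : ℕ) : ℝ :=
  if i = j then (if i = 0 then 1 + α else 2 + α)
  else if i + 1 = j ∨ j + 1 = i then -1 else 0

/-- Row `i` of the product with a sequence; truncated subtraction makes the `i - 1` term vanish
at `i = 0`. -/
lemma sum_tridiagEntry_mul (α : ℝ) (n : ℕ) (f : ℕ → ℝ) {i : ℕ} (hi : i < n + 1) :
    ∑ j ∈ Finset.range (n + 1), tridiagEntry α i j * f j =
      α * f i + (f i - f (i - 1)) + (f i - f (i + 1)) + if i = n then f (n + 1) else 0 := by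
  have hterm : ∀ j, tridiagEntry α i j * f j =
      (if j = i then (if i = 0 then 1 + α else 2 + α) * f j else 0)
        - (if j = i + 1 then f j else 0)
        - (if j = i - 1 then (if i = 0 then 0 else f j) else 0) := by
    intro j
    unfold tridiagEntry
    split_ifs <;> first | omega | ring
  simp only [hterm, Finset.sum_sub_distrib, Finset.sum_ite_eq', Finset.mem_range]
  rcases Nat.eq_zero_or_pos i with rfl | h0
  · by_cases hn : n = 0
    · subst hn
      simp
      ring
    · simp [Ne.symm hn, Nat.pos_of_ne_zero hn]
      ring
  · have h1 : i - 1 < n + 1 := by omega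
    by_cases hn : i = n
    · subst hn
      simp [h0.ne', h1]
      ring
    · have h2 : i < n := by omega
      simp [h0.ne', h1, hn, h2, h2.le]
      ring

lemma sq_le_sum_mul_sub (f : ℕ → ℝ) (n : ℕ) :
    f n ^ 2 ≤ ∑ i ∈ Finset.range (n + 1), f i * ((f i - f (i - 1)) + (f i - f (i + 1)))
      + f n * f (n + 1) := by
  induction n with
  | zero => simp; nlinarith
  | succ n ih =>
    rw [Finset.sum_range_succ, Nat.add_sub_cancel]
    nlinarith [sq_nonneg (f n - f (n + 1))]

/-- The quadratic form of the tridiagonal matrix is bounded below by `α` times the squared norm. -/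
lemma mul_sum_sq_le_sum_tridiagEntry (α : ℝ) (n : ℕ) (f : ℕ → ℝ) :
    α * ∑ i ∈ Finset.range (n + 1), f i ^ 2 ≤
      ∑ i ∈ Finset.range (n + 1),
        f i * ∑ j ∈ Finset.range (n + 1), tridiagEntry α i j * f j := by
  have hrow : ∀ i ∈ Finset.range (n + 1),
      f i * ∑ j ∈ Finset.range (n + 1), tridiagEntry α i j * f j =
        α * f i ^ 2 + f i * ((f i - f (i - 1)) + (f i - f (i + 1)))
          + if i = n then f i * f (n + 1) else 0 := by
    intro i hi
    rw [sum_tridiagEntry_mul α n f (Finset.mem_range.1 hi)]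
    split_ifs <;> ring
  rw [Finset.sum_congr rfl hrow, Finset.sum_add_distrib, Finset.sum_add_distrib,
    ← Finset.mul_sum, Finset.sum_ite_eq', if_pos (Finset.self_mem_range_succ n)]
  linarith [sq_le_sum_mul_sub f n, sq_nonneg (f n)]

lemma mul_sum_sq_le_dotProduct_mulVec (α : ℝ) (n : ℕ) (T : Matrix (Fin (n + 1)) (Fin (n + 1)) ℝ)
    (hT : ∀ i j, T i j = tridiagEntry α i j) (v : Fin (n + 1) → ℝ) :
    α * ∑ i, v i ^ 2 ≤ ∑ i, v i * T.mulVec v i := by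
  obtain ⟨f, hf⟩ : ∃ f : ℕ → ℝ, ∀ i : Fin (n + 1), v i = f i :=
    ⟨fun k => if h : k < n + 1 then v ⟨k, h⟩ else 0, fun i => by simp only [i.isLt, dif_pos]⟩
  simp only [Matrix.mulVec, dotProduct, hT, hf]
  have h := mul_sum_sq_le_sum_tridiagEntry α n f
  simpa only [Finset.sum_range] using h

lemma tridiag_mulVec_geometric {α q : ℝ} (hq : q ^ 2 - (2 + α) * q + 1 = 0) (hq1 : q < 1) (n : ℕ)
    (T : Matrix (Fin (n + 1)) (Fin (n + 1)) ℝ) (hT : ∀ i j, T i j = tridiagEntry α i j)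
    (i : Fin (n + 1)) :
    T.mulVec (fun j => q ^ ((j : ℕ) + 1) / (1 - q)) i =
      (if (i : ℕ) = 0 then 1 else 0) + if (i : ℕ) = n then q ^ (n + 2) / (1 - q) else 0 := by
  have h := sum_tridiagEntry_mul α n (fun k => q ^ (k + 1) / (1 - q)) i.isLt
  simp only [Finset.sum_range] at h
  simp only [Matrix.mulVec, dotProduct, hT, h]
  congr 1
  have hne : 1 - q ≠ 0 := by linarith
  rcases (i : ℕ) with _ | k
  · simp
    field_simp
    linear_combination -hq
  · simp
    field_simp
    linear_combination -q ^ (k + 1) * hq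

/-- Lemma 2 of the paper (Lemma 3.3 of Zhang et al.): for the tridiagonal matrix `T`
with `T₁₁ = 1+α`, `T_{ii} = 2+α` (`i ≥ 2`), `T_{i,i±1} = −1`, `T` is positive definite
and the solution `y*` of `T y = e₁` is approximated by the geometric vector
`ȳ_i = qⁱ/(1−q)` with error at most `q^{d+1}/(α(1−q))` in Euclidean norm. -/
theorem stmt_0 (d : ℕ) (hd : 1 ≤ d) (α : ℝ) (hα : 0 < α)
    (q : ℝ) (hq : q = ((2 + α) - Real.sqrt (α ^ 2 + 4 * α)) / 2)
    (T : Matrix (Fin d) (Fin d) ℝ)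
    (hT : ∀ i j : Fin d,
      T i j = if i = j then (if (i : ℕ) = 0 then 1 + α else 2 + α)
        else if (i : ℕ) + 1 = (j : ℕ) ∨ (j : ℕ) + 1 = (i : ℕ) then -1 else 0)
    (ybar : Fin d → ℝ) (hybar : ∀ i : Fin d, ybar i = q ^ ((i : ℕ) + 1) / (1 - q)) :
    T.PosDef ∧
      ∀ ystar : Fin d → ℝ,
        T.mulVec ystar = (fun i : Fin d => if (i : ℕ) = 0 then (1 : ℝ) else 0) →
        Real.sqrt (∑ i, (ybar i - ystar i) ^ 2) ≤ q ^ (d + 1) / (α * (1 - q)) := by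
  obtain ⟨n, rfl⟩ : ∃ n, d = n + 1 := ⟨d - 1, by omega⟩
  have hT' : ∀ i j, T i j = tridiagEntry α i j := fun i j => by
    simp only [hT, tridiagEntry, Fin.ext_iff]
  have hs := Real.sq_sqrt (show 0 ≤ α ^ 2 + 4 * α by positivity)
  have hroot : q ^ 2 - (2 + α) * q + 1 = 0 := by
    rw [hq]
    linear_combination hs / 4
  have hq1 : q < 1 := by
    have : α < Real.sqrt (α ^ 2 + 4 * α) := Real.lt_sqrt_of_sq_lt (by linarith)
    rw [hq]
    linarith
  have hq0 : 0 < q := by nlinarith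
  have hform := mul_sum_sq_le_dotProduct_mulVec α n T hT'
  refine ⟨Matrix.PosDef.of_dotProduct_mulVec_pos ?_ fun v hv => ?_, fun y hy => ?_⟩
  · ext i j
    simp only [Matrix.conjTranspose_apply, star_trivial, hT', tridiagEntry]
    split_ifs <;> first | rfl | omega
  · obtain ⟨i, hi⟩ := Function.ne_iff.1 hv
    have hpos : 0 < ∑ i, v i ^ 2 :=
      Finset.sum_pos' (fun i _ => sq_nonneg _) ⟨i, Finset.mem_univ i, sq_pos_of_ne_zero hi⟩
    simpa [dotProduct] using (mul_pos hα hpos).trans_le (hform v)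
  · have hres : ∀ i, T.mulVec (ybar - y) i =
        if i = Fin.last n then q ^ (n + 2) / (1 - q) else 0 := by
      intro i
      rw [Matrix.mulVec_sub, hy, funext hybar, Pi.sub_apply,
        tridiag_mulVec_geometric hroot hq1 n T hT' i]
      simp only [Fin.ext_iff, Fin.val_last, add_sub_cancel_left]
    have hle := hform (ybar - y)
    simp only [hres, mul_ite, mul_zero, Finset.sum_ite_eq', Finset.mem_univ, if_true,
      Pi.sub_apply] at hle
    have hS : 0 ≤ ∑ i, (ybar i - y i) ^ 2 := Finset.sum_nonneg fun i _ => sq_nonneg _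
    have hlast : ybar (Fin.last n) - y (Fin.last n) ≤ Real.sqrt (∑ i, (ybar i - y i) ^ 2) :=
      Real.le_sqrt_of_sq_le (Finset.single_le_sum (f := fun i => (ybar i - y i) ^ 2)
        (fun i _ => sq_nonneg _) (Finset.mem_univ (Fin.last n)))
    have hc : 0 < q ^ (n + 2) / (1 - q) := div_pos (by positivity) (by linarith)
    rw [← Real.sq_sqrt hS] at hle
    set s := Real.sqrt (∑ i, (ybar i - y i) ^ 2)
    have hs_nonneg : 0 ≤ s := Real.sqrt_nonneg _
    rw [mul_comm α, ← div_div, le_div_iff₀ hα]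
    rcases hs_nonneg.eq_or_lt with h0 | h0
    · rw [← h0, zero_mul]
      exact hc.le
    · refine le_of_mul_le_mul_right ?_ h0
      nlinarith [mul_le_mul_of_nonneg_right hlast hc.le]
end

section
/- Let d ≥ 1 be an integer, α > 0, and let q = ((2+α) − √(α² + 4α))/2 be the smaller root of q² − (2+α)q + 1 = 0. Let T ∈ ℝ^{d×d} be the tridiagonal matrix with T₁₁ = 1+α, T_{ii} = 2+α for 2 ≤ i ≤ d, T_{i,i+1} = T_{i+1,i} = −1 for 1 ≤ i ≤ d−1, and all other entries zero, and let ȳ ∈ ℝ^d have coordinates ȳ_i = q^i/(1−q) for i = 1,…,d. Then T ȳ = e₁ + (q^{d+1}/(1−q)) e_d, where e₁ and e_d are the first and last standard basis vectors of ℝ^d. -/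
/-- A sum against a row of a tridiagonal matrix with off-diagonal entries `-1`. -/
theorem sum_tridiagonal_row (d i : ℕ) (hi : i < d) (a : ℝ) (f : ℕ → ℝ) :
    ∑ j : Fin d, (if i = (j : ℕ) then a
      else if i + 1 = (j : ℕ) ∨ (j : ℕ) + 1 = i then -1 else 0) * f j =
      a * f i - (if i + 1 < d then f (i + 1) else 0) - (if i = 0 then 0 else f (i - 1)) := by
  rw [Fin.sum_univ_eq_sum_range (fun j => (if i = j then a
    else if i + 1 = j ∨ j + 1 = i then -1 else 0) * f j)]
  have hsplit : ∀ j ∈ Finset.range d,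
      (if i = j then a else if i + 1 = j ∨ j + 1 = i then -1 else 0) * f j =
        (if i = j then a * f j else 0) - (if i + 1 = j then f j else 0)
          - (if i - 1 = j then (if i = 0 then 0 else f j) else 0) := by
    intro j _
    grind
  rw [Finset.sum_congr rfl hsplit, Finset.sum_sub_distrib, Finset.sum_sub_distrib]
  simp only [Finset.sum_ite_eq, Finset.mem_range, hi, if_true]
  rw [if_pos (show i - 1 < d by omega)]

/-- The smaller root of `x ^ 2 - (2 + α) * x + 1`. -/
theorem sq_eq_of_eq_smaller_root {α q : ℝ} (hα : 0 < α)
    (hq : q = ((2 + α) - Real.sqrt (α ^ 2 + 4 * α)) / 2) : q ^ 2 = (2 + α) * q - 1 := by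
  have hs := Real.sq_sqrt (show 0 ≤ α ^ 2 + 4 * α by positivity)
  rw [hq]
  linear_combination hs / 4

/-- The key identity inside Lemma 2 of the paper: the geometric vector
`ȳ_i = qⁱ/(1−q)` solves the tridiagonal system `T y = e₁` up to a residual
`(q^{d+1}/(1−q)) e_d` in the last coordinate. -/
theorem stmt_1 (d : ℕ) (hd : 1 ≤ d) (α : ℝ) (hα : 0 < α)
    (q : ℝ) (hq : q = ((2 + α) - Real.sqrt (α ^ 2 + 4 * α)) / 2)
    (T : Matrix (Fin d) (Fin d) ℝ)
    (hT : ∀ i j : Fin d,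
      T i j = if i = j then (if (i : ℕ) = 0 then 1 + α else 2 + α)
        else if (i : ℕ) + 1 = (j : ℕ) ∨ (j : ℕ) + 1 = (i : ℕ) then -1 else 0)
    (ybar : Fin d → ℝ) (hybar : ∀ i : Fin d, ybar i = q ^ ((i : ℕ) + 1) / (1 - q)) :
    T.mulVec ybar = fun i : Fin d =>
      (if (i : ℕ) = 0 then (1 : ℝ) else 0) +
        (if (i : ℕ) = d - 1 then q ^ (d + 1) / (1 - q) else 0) := by
  have hroot := sq_eq_of_eq_smaller_root hα hq
  have hq1 : 1 - q ≠ 0 := by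
    intro h
    have h1 : q = 1 := by linarith
    rw [h1] at hroot
    linarith
  funext i
  obtain ⟨i, hi⟩ := i
  simp only [Matrix.mulVec, dotProduct, hT, hybar, Fin.ext_iff]
  rw [sum_tridiagonal_row d i hi _ (fun j => q ^ (j + 1) / (1 - q))]
  have hlast : (if i + 1 < d then q ^ (i + 1 + 1) / (1 - q) else 0) =
      q ^ (i + 2) / (1 - q) - (if i = d - 1 then q ^ (d + 1) / (1 - q) else 0) := by
    by_cases h : i + 1 < d
    · rw [if_pos h, if_neg (by omega), sub_zero]
    · obtain rfl : d = i + 1 := by omega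
      simp
  rw [hlast]
  rcases i with _ | k
  · simp only [if_true]
    field_simp
    linear_combination -hroot
  · simp only [Nat.add_eq_zero_iff, one_ne_zero, and_false, if_false, Nat.add_sub_cancel]
    field_simp
    linear_combination -q ^ (k + 1) * hroot
end

section
/- Let q ∈ (0,1), and let k, d be integers with 1 ≤ k and 2k ≤ d. Let ȳ ∈ ℝ^d have coordinates ȳ_i = q^i/(1−q) for i = 1,…,d. Then every ŷ ∈ ℝ^d whose coordinates ŷ_j vanish for all j with k < j ≤ d satisfies ‖ŷ − ȳ‖ ≥ (q^k/√2)·‖ȳ‖. -/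
/-- For an antitone nonnegative sequence, the sum of the first `m + k` terms is at most twice
the sum of the first `m` terms, provided `k ≤ m`. -/
theorem sum_range_add_le_two_mul_of_antitone {f : ℕ → ℝ} (hf : Antitone f) (h0 : ∀ i, 0 ≤ f i)
    {k m : ℕ} (hkm : k ≤ m) :
    ∑ i ∈ Finset.range (m + k), f i ≤ 2 * ∑ i ∈ Finset.range m, f i := by
  have tail_le : ∑ i ∈ Finset.range k, f (m + i) ≤ ∑ i ∈ Finset.range k, f i :=
    Finset.sum_le_sum fun i _ => hf (Nat.le_add_left i m)
  have head_le : ∑ i ∈ Finset.range k, f i ≤ ∑ i ∈ Finset.range m, f i :=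
    Finset.sum_le_sum_of_subset_of_nonneg (Finset.range_mono hkm) fun i _ _ => h0 i
  rw [Finset.sum_range_add]
  linarith

/-- Tail lower bound from the proof of Lemma 3 of the paper: any vector `ŷ`
supported on the first `k` coordinates satisfies `‖ŷ − ȳ‖ ≥ (q^k/√2)·‖ȳ‖`
for the geometric vector `ȳ_i = qⁱ/(1−q)`, whenever `1 ≤ k` and `2k ≤ d`. -/
theorem stmt_2 (d k : ℕ) (hk : 1 ≤ k) (hkd : 2 * k ≤ d)
    (q : ℝ) (hq0 : 0 < q) (hq1 : q < 1)
    (ybar : Fin d → ℝ) (hybar : ∀ i : Fin d, ybar i = q ^ ((i : ℕ) + 1) / (1 - q))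
    (yhat : Fin d → ℝ) (hyhat : ∀ j : Fin d, k < (j : ℕ) + 1 → yhat j = 0) :
    (q ^ k / Real.sqrt 2) * Real.sqrt (∑ i, (ybar i) ^ 2) ≤
      Real.sqrt (∑ i, (yhat i - ybar i) ^ 2) := by
  obtain ⟨m, rfl⟩ : ∃ m, d = k + m := ⟨d - k, by omega⟩
  have hq : 0 < 1 - q := sub_pos.2 hq1
  set f : ℕ → ℝ := fun i => (q ^ (i + 1) / (1 - q)) ^ 2 with hf
  have f_anti : Antitone f := fun i j hij => by
    have := pow_le_pow_of_le_one hq0.le hq1.le (Nat.succ_le_succ hij)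
    simp only [hf]
    gcongr
  have sum_ybar : ∑ i, (ybar i) ^ 2 = ∑ i ∈ Finset.range (m + k), f i := by
    rw [add_comm m k, Finset.sum_range]
    exact Finset.sum_congr rfl fun i _ => by rw [hybar]
  have tail_le : (q ^ k) ^ 2 * ∑ i ∈ Finset.range m, f i ≤ ∑ i, (yhat i - ybar i) ^ 2 := by
    rw [Fin.sum_univ_add, Finset.sum_range, Finset.mul_sum]
    refine le_add_of_nonneg_of_le (Finset.sum_nonneg fun i _ => sq_nonneg _) ?_
    refine Finset.sum_le_sum fun i _ => le_of_eq ?_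
    rw [hyhat _ (by simp only [Fin.val_natAdd]; omega), hybar, Fin.val_natAdd]
    simp only [hf]
    ring
  have sum_le := sum_range_add_le_two_mul_of_antitone f_anti (fun i => sq_nonneg _)
    (show k ≤ m by omega)
  apply Real.le_sqrt_of_sq_le
  rw [mul_pow, div_pow, Real.sq_sqrt zero_le_two,
    Real.sq_sqrt (Finset.sum_nonneg fun i _ => sq_nonneg _), sum_ybar]
  nlinarith [mul_le_mul_of_nonneg_left sum_le (sq_nonneg (q ^ k))]
end

section
/- Let α > 0 and let q = ((2+α) − √(α² + 4α))/2 be the smaller root of q² − (2+α)q + 1 = 0. Let k, d be integers with 1 ≤ k, 2k ≤ d, and suppose q^d ≤ α²/32. Let T ∈ ℝ^{d×d} be the tridiagonal matrix with T₁₁ = 1+α, T_{ii} = 2+α for 2 ≤ i ≤ d, T_{i,i+1} = T_{i+1,i} = −1 for 1 ≤ i ≤ d−1, and all other entries zero, and let y* be the unique solution of T y = e₁. Then every ŷ ∈ ℝ^d whose coordinates ŷ_j vanish for all j with k < j ≤ d satisfies ‖ŷ − y*‖² ≥ (q^{2k}/16)·‖y*‖². -/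
/-- For `q ∈ (0, 1)` with inverse `r`, the sequence `r ^ m - q ^ m` grows by a factor of at most
`2 * r ^ k` over `k` steps, once `k ≤ m`. -/
lemma pow_mul_pow_sub_pow_le {q r : ℝ} (hq : 0 < q) (hq1 : q < 1) (hqr : q * r = 1) {k m : ℕ}
    (hkm : k ≤ m) : q ^ k * (r ^ (m + k) - q ^ (m + k)) ≤ 2 * (r ^ m - q ^ m) := by
  have hm : q ^ m * r ^ m = 1 := by rw [← mul_pow, hqr, one_pow]
  have hk : q ^ k * r ^ k = 1 := by rw [← mul_pow, hqr, one_pow]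
  have ha : 0 < q ^ m := pow_pos hq m
  have hap : q ^ m ≤ q ^ k := pow_le_pow_of_le_one hq.le hq1.le hkm
  have hb : 0 < r ^ m := by
    by_contra! h
    nlinarith [mul_nonpos_of_nonneg_of_nonpos ha.le h]
  have hexp : q ^ k * (r ^ (m + k) - q ^ (m + k)) = r ^ m - q ^ m * (q ^ k) ^ 2 := by
    rw [pow_add, pow_add]
    linear_combination r ^ m * hk
  rw [hexp]
  generalize q ^ m = a at *
  generalize q ^ k = p at *
  generalize r ^ m = b at *
  have hsq : a * a ^ 2 ≤ a * p ^ 2 := by gcongr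
  have hcube : b + a ^ 3 - 2 * a = b * (1 - a ^ 2) ^ 2 := by
    linear_combination (2 * a - a ^ 3) * hm
  have : 0 ≤ b * (1 - a ^ 2) ^ 2 := by positivity
  nlinarith

lemma pow_sub_pow_nonneg {q r : ℝ} (hq : 0 < q) (hqr : q ≤ r) (m : ℕ) : 0 ≤ r ^ m - q ^ m :=
  sub_nonneg.2 (pow_le_pow_left₀ hq.le hqr m)

lemma pow_mul_sq_pow_sub_pow_le {q r : ℝ} (hq : 0 < q) (hq1 : q < 1) (hr : 1 ≤ r)
    (hqr : q * r = 1) {k m : ℕ} (hkm : k ≤ m) :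
    q ^ (2 * k) * (r ^ (m + k) - q ^ (m + k)) ^ 2 ≤ 4 * (r ^ m - q ^ m) ^ 2 := by
  have h := pow_mul_pow_sub_pow_le hq hq1 hqr hkm
  have h0 : 0 ≤ q ^ k * (r ^ (m + k) - q ^ (m + k)) :=
    mul_nonneg (pow_nonneg hq.le k) (pow_sub_pow_nonneg hq (hq1.le.trans hr) _)
  calc _ = (q ^ k * (r ^ (m + k) - q ^ (m + k))) ^ 2 := by ring
    _ ≤ (2 * (r ^ m - q ^ m)) ^ 2 := by gcongr
    _ = _ := by ring

lemma pow_sub_pow_le_succ {q r : ℝ} (hq : 0 < q) (hq1 : q < 1) (hr : 1 ≤ r) (m : ℕ) :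
    r ^ m - q ^ m ≤ r ^ (m + 1) - q ^ (m + 1) :=
  sub_le_sub (pow_le_pow_right₀ hr m.le_succ) (pow_le_pow_of_le_one hq.le hq1.le m.le_succ)

lemma pow_mul_sum_range_two_mul_le {q r : ℝ} (hq : 0 < q) (hq1 : q < 1) (hr : 1 ≤ r)
    (hqr : q * r = 1) {k n : ℕ} (hn : n ≤ k) :
    q ^ (2 * k) * ∑ m ∈ Finset.range (2 * n), (r ^ (m + 1) - q ^ (m + 1)) ^ 2 ≤
      8 * ∑ m ∈ Finset.range n, (r ^ (m + 1) - q ^ (m + 1)) ^ 2 := by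
  induction n with
  | zero => simp
  | succ n ih =>
    have ih := ih (by omega)
    rw [show 2 * (n + 1) = 2 * n + 1 + 1 by ring, Finset.sum_range_succ, Finset.sum_range_succ,
      Finset.sum_range_succ _ n]
    have hkey := pow_mul_sq_pow_sub_pow_le hq hq1 hr hqr (le_refl (n + 1))
    rw [show n + 1 + (n + 1) = 2 * n + 1 + 1 by ring] at hkey
    have hmono : (r ^ (2 * n + 1) - q ^ (2 * n + 1)) ^ 2 ≤
        (r ^ (2 * n + 1 + 1) - q ^ (2 * n + 1 + 1)) ^ 2 :=
      pow_le_pow_left₀ (pow_sub_pow_nonneg hq (hq1.le.trans hr) _)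
        (pow_sub_pow_le_succ hq hq1 hr _) 2
    have hpow : q ^ (2 * k) ≤ q ^ (2 * (n + 1)) :=
      pow_le_pow_of_le_one hq.le hq1.le (by omega)
    have hlast := (mul_le_mul_of_nonneg_right hpow
      (sq_nonneg (r ^ (2 * n + 1 + 1) - q ^ (2 * n + 1 + 1)))).trans hkey
    have hprev := mul_le_mul_of_nonneg_left hmono (pow_nonneg hq.le (2 * k))
    linarith

/-- The sum of the first `d` squares of `r ^ m - q ^ m` is controlled by the sum of the first
`d - k` of them. -/
lemma pow_mul_sum_range_le {q r : ℝ} (hq : 0 < q) (hq1 : q < 1) (hr : 1 ≤ r)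
    (hqr : q * r = 1) {k d : ℕ} (hkd : 2 * k ≤ d) :
    q ^ (2 * k) * ∑ m ∈ Finset.range d, (r ^ (m + 1) - q ^ (m + 1)) ^ 2 ≤
      8 * ∑ m ∈ Finset.range (d - k), (r ^ (m + 1) - q ^ (m + 1)) ^ 2 := by
  obtain ⟨e, rfl⟩ := Nat.exists_eq_add_of_le hkd
  rw [show 2 * k + e - k = k + e by omega, Finset.sum_range_add, Finset.sum_range_add, mul_add,
    mul_add]
  refine add_le_add (pow_mul_sum_range_two_mul_le hq hq1 hr hqr le_rfl) ?_
  rw [Finset.mul_sum, Finset.mul_sum]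
  refine Finset.sum_le_sum fun x _ => ?_
  have h := pow_mul_sq_pow_sub_pow_le hq hq1 hr hqr (show k ≤ k + x + 1 by omega)
  rw [show k + x + 1 + k = 2 * k + x + 1 by ring] at h
  linarith [sq_nonneg (r ^ (k + x + 1) - q ^ (k + x + 1))]

/-- A second-order linear recurrence started at `0`, with characteristic roots `q` and `r`. -/
lemma mul_sub_eq_of_recurrence {q r : ℝ} (hqr : q * r = 1) {d : ℕ} {Y : ℕ → ℝ} (h0 : Y 0 = 0)
    (hY : ∀ m, m + 1 < d → Y (m + 2) = (q + r) * Y (m + 1) - Y m) :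
    ∀ m, m ≤ d → Y m * (r - q) = Y 1 * (r ^ m - q ^ m) := by
  intro m
  induction m using Nat.twoStepInduction with
  | zero => simp [h0]
  | one => simp
  | more m ih₀ ih₁ =>
    intro hm
    rw [hY m (by omega)]
    have ih₀ := ih₀ (by omega)
    have ih₁ := ih₁ (by omega)
    linear_combination (q + r) * ih₁ - ih₀ + Y 1 * (r ^ m - q ^ m) * hqr

/-- The extension by zero of a vector indexed by `Fin d`. -/
def extendZero {d : ℕ} (y : Fin d → ℝ) (i : ℕ) : ℝ := if h : i < d then y ⟨i, h⟩ else 0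

@[simp]
lemma extendZero_val {d : ℕ} (y : Fin d → ℝ) (i : Fin d) : extendZero y i = y i := by
  simp [extendZero]

lemma extendZero_of_le {d : ℕ} (y : Fin d → ℝ) {i : ℕ} (h : d ≤ i) : extendZero y i = 0 := by
  simp [extendZero, h]

lemma tridiagonal_row {d : ℕ} {α : ℝ} {T : Matrix (Fin d) (Fin d) ℝ}
    (hT : ∀ i j : Fin d,
      T i j = if i = j then (if (i : ℕ) = 0 then 1 + α else 2 + α)
        else if (i : ℕ) + 1 = (j : ℕ) ∨ (j : ℕ) + 1 = (i : ℕ) then -1 else 0)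
    (y : Fin d → ℝ) {i : ℕ} (hi : i + 1 < d) :
    T.mulVec y ⟨i + 1, hi⟩ =
      (2 + α) * extendZero y (i + 1) - extendZero y (i + 2) - extendZero y i := by
  have hterm : ∀ j : Fin d, T ⟨i + 1, hi⟩ j * y j =
      (if i + 1 = (j : ℕ) then (2 + α) * extendZero y j else 0)
        - (if i + 2 = (j : ℕ) then extendZero y j else 0)
        - (if i = (j : ℕ) then extendZero y j else 0) := by
    intro j
    rw [hT, extendZero_val]
    simp only [Fin.ext_iff]
    split_ifs <;> first | contradiction | omega | ring
  have hsum : ∀ j (c : ℝ), ∑ x ∈ Finset.range d, (if j = x then c * extendZero y x else 0) =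
      c * extendZero y j := by
    intro j c
    rw [Finset.sum_ite_eq]
    split_ifs with h
    · rfl
    · rw [extendZero_of_le y (by simpa using h), mul_zero]
  have hsum_one := fun j => hsum j 1
  simp only [one_mul] at hsum_one
  rw [Matrix.mulVec, dotProduct, Finset.sum_congr rfl fun j _ => hterm j,
    Fin.sum_univ_eq_sum_range (fun x =>
      (if i + 1 = x then (2 + α) * extendZero y x else 0)
        - (if i + 2 = x then extendZero y x else 0)
        - (if i = x then extendZero y x else 0)),
    Finset.sum_sub_distrib, Finset.sum_sub_distrib, hsum, hsum_one, hsum_one]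

/-- Analytic core of Lemma 3 of the paper: if `q^d ≤ α²/32`, any vector `ŷ`
supported on the first `k` coordinates is at squared Euclidean distance at least
`(q^{2k}/16)·‖y*‖²` from the solution `y*` of the tridiagonal system `T y = e₁`. -/
theorem stmt_3 (d k : ℕ) (hk : 1 ≤ k) (hkd : 2 * k ≤ d)
    (α : ℝ) (hα : 0 < α)
    (q : ℝ) (hq : q = ((2 + α) - Real.sqrt (α ^ 2 + 4 * α)) / 2)
    (hqd : q ^ d ≤ α ^ 2 / 32)
    (T : Matrix (Fin d) (Fin d) ℝ)
    (hT : ∀ i j : Fin d,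
      T i j = if i = j then (if (i : ℕ) = 0 then 1 + α else 2 + α)
        else if (i : ℕ) + 1 = (j : ℕ) ∨ (j : ℕ) + 1 = (i : ℕ) then -1 else 0)
    (ystar : Fin d → ℝ)
    (hystar : T.mulVec ystar = fun i : Fin d => if (i : ℕ) = 0 then (1 : ℝ) else 0) :
    ∀ yhat : Fin d → ℝ, (∀ j : Fin d, k < (j : ℕ) + 1 → yhat j = 0) →
      (q ^ (2 * k) / 16) * (∑ i, (ystar i) ^ 2) ≤ ∑ i, (yhat i - ystar i) ^ 2 := by
  have hs : Real.sqrt (α ^ 2 + 4 * α) ^ 2 = α ^ 2 + 4 * α := Real.sq_sqrt (by positivity)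
  have hs0 : 0 ≤ Real.sqrt (α ^ 2 + 4 * α) := Real.sqrt_nonneg _
  generalize Real.sqrt (α ^ 2 + 4 * α) = s at *
  have hsα : α < s := by nlinarith
  have hs2 : s < 2 + α := by nlinarith
  obtain ⟨r, hr⟩ : ∃ r, r = 2 + α - q := ⟨_, rfl⟩
  have hq0 : 0 < q := by rw [hq]; linarith
  have hq1 : q < 1 := by rw [hq]; linarith
  have hr1 : 1 < r := by linarith
  have hqr : q * r = 1 := by
    rw [hr, hq]
    linear_combination -hs / 4
  intro yhat hyhat
  have hrec := mul_sub_eq_of_recurrence hqr (d := d) (Y := fun m => extendZero ystar (d - m))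
    (extendZero_of_le _ le_rfl) (by
      intro m hm
      obtain ⟨i, rfl⟩ : ∃ i, d = i + m + 2 := ⟨d - m - 2, by omega⟩
      have hrow := tridiagonal_row hT ystar (i := i) (by omega)
      rw [hystar] at hrow
      simp only [Nat.add_eq_zero_iff, one_ne_zero, and_false, if_false] at hrow
      simp only [show i + m + 2 - (m + 2) = i by omega, show i + m + 2 - (m + 1) = i + 1 by omega,
        show i + m + 2 - m = i + 2 by omega, hr]
      linarith)
  obtain ⟨c, hc⟩ : ∃ c, c = extendZero ystar (d - 1) / (r - q) := ⟨_, rfl⟩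
  have hsol : ∀ m, m < d →
      extendZero ystar (d - 1 - m) ^ 2 = c ^ 2 * (r ^ (m + 1) - q ^ (m + 1)) ^ 2 := by
    intro m hm
    have hrq : r - q ≠ 0 := by linarith
    have h := hrec (m + 1) hm
    simp only [show d - (m + 1) = d - 1 - m by omega] at h
    rw [eq_div_of_mul_eq hrq h, hc]
    ring
  have hstar : ∑ i, ystar i ^ 2 =
      c ^ 2 * ∑ m ∈ Finset.range d, (r ^ (m + 1) - q ^ (m + 1)) ^ 2 := by
    have h := Fin.sum_univ_eq_sum_range (fun i => extendZero ystar i ^ 2) d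
    simp only [extendZero_val] at h
    rw [h, ← Finset.sum_range_reflect, Finset.mul_sum]
    exact Finset.sum_congr rfl fun m hm => hsol m (Finset.mem_range.1 hm)
  have hdiff : c ^ 2 * ∑ m ∈ Finset.range (d - k), (r ^ (m + 1) - q ^ (m + 1)) ^ 2 ≤
      ∑ i, (yhat i - ystar i) ^ 2 := by
    have h := Fin.sum_univ_eq_sum_range
      (fun i => (extendZero yhat i - extendZero ystar i) ^ 2) d
    simp only [extendZero_val] at h
    rw [h, ← Finset.sum_range_reflect (fun i => (extendZero yhat i - extendZero ystar i) ^ 2),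
      Finset.mul_sum]
    refine le_trans (Finset.sum_le_sum fun m hm => ?_) (Finset.sum_le_sum_of_subset_of_nonneg
      (Finset.range_subset_range.2 (Nat.sub_le d k)) fun _ _ _ => sq_nonneg _)
    have hm := Finset.mem_range.1 hm
    have hzero : extendZero yhat (d - 1 - m) = 0 := by
      rw [extendZero, dif_pos (by omega)]
      exact hyhat _ (by simp only; omega)
    rw [← hsol m (by omega), hzero, zero_sub, neg_sq]
  have hmain := mul_le_mul_of_nonneg_left
    (pow_mul_sum_range_le hq0 hq1 hr1.le hqr hkd) (sq_nonneg c)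
  have hnonneg : 0 ≤ ∑ i, (yhat i - ystar i) ^ 2 := Finset.sum_nonneg fun _ _ => sq_nonneg _
  rw [hstar]
  linarith
end

section
/- Let d ≥ 1 and M ≥ 1 be integers, p ≥ 1 an integer, μ > 0, δ > 0, and A ∈ ℝ^{d×d} an arbitrary matrix. Define f : ℝ^d × ℝ^d → ℝ by f(x,y) = (pδ/(2M))·xᵀAy + (16pμ/M)·‖x‖² − (16pμ/M)·‖y‖² + (pδ²/(128Mμ))·y₁, where y₁ is the first coordinate of y. Set α = (64μ/δ)². Then AᵀA + αI is positive definite (hence invertible), and the point (x*, y*) given by y* = (AᵀA + αI)⁻¹ e₁ and x* = −(δ/(64μ))·A y* is a saddle point of f: f(x*, y) ≤ f(x*, y*) ≤ f(x, y*) for all x, y ∈ ℝ^d; moreover both partial gradients ∇ₓ f and ∇ᵧ f vanish at (x*, y*). -/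
open Matrix

/-- A function of the form `k + c‖x - a‖²` has vanishing gradient at `a`. -/
theorem hasGradientAt_zero_of_eq_add_mul_norm_sub_sq {E : Type*} [NormedAddCommGroup E]
    [InnerProductSpace ℝ E] [CompleteSpace E] {g : E → ℝ} {a : E} {k c : ℝ}
    (h : ∀ x, g x = k + c * ‖x - a‖ ^ 2) : HasGradientAt g 0 a := by
  obtain rfl : g = fun x => k + c * ‖x - a‖ ^ 2 := funext h
  rw [hasGradientAt_iff_hasFDerivAt]
  have := ((((hasFDerivAt_id (𝕜 := ℝ) a).sub_const a).norm_sq).const_mul c).const_add k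
  simpa using this

/-- The Gram matrix `AᵀA` shifted by a positive multiple of the identity is positive definite. -/
theorem posDef_transpose_mul_self_add_smul_one {m n : Type*} [Fintype m] [Fintype n]
    [DecidableEq n] (A : Matrix m n ℝ) {α : ℝ} (hα : 0 < α) :
    (Aᵀ * A + α • (1 : Matrix n n ℝ)).PosDef := by
  have h : (Aᵀ * A).PosSemidef := by
    simpa [conjTranspose_eq_transpose_of_trivial] using posSemidef_conjTranspose_mul_self A
  exact Matrix.PosDef.posSemidef_add h (Matrix.PosDef.one.smul hα)

/-- Saddle point of the global objective of the paper's hard instance: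
`f(x,y) = (pδ/(2M))·xᵀAy + (16pμ/M)·‖x‖² − (16pμ/M)·‖y‖² + (pδ²/(128Mμ))·y₁`.
With `α = (64μ/δ)²`, the matrix `AᵀA + αI` is positive definite (hence invertible),
and `y* = (AᵀA + αI)⁻¹e₁`, `x* = −(δ/(64μ))Ay*` give a saddle point of `f`, at which
both partial gradients vanish. -/
theorem stmt_6 (d M p : ℕ) (hd : 1 ≤ d) (hM : 1 ≤ M) (hp : 1 ≤ p)
    (μ δ : ℝ) (hμ : 0 < μ) (hδ : 0 < δ)
    (A : Matrix (Fin d) (Fin d) ℝ)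
    (f : EuclideanSpace ℝ (Fin d) → EuclideanSpace ℝ (Fin d) → ℝ)
    (hf : ∀ x y : EuclideanSpace ℝ (Fin d),
      f x y = ((p : ℝ) * δ / (2 * (M : ℝ))) * (∑ i, ∑ j, x i * A i j * y j)
        + (16 * (p : ℝ) * μ / (M : ℝ)) * ‖x‖ ^ 2
        - (16 * (p : ℝ) * μ / (M : ℝ)) * ‖y‖ ^ 2
        + ((p : ℝ) * δ ^ 2 / (128 * (M : ℝ) * μ)) * y ⟨0, hd⟩)
    (α : ℝ) (hαdef : α = (64 * μ / δ) ^ 2) :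
    (Aᵀ * A + α • (1 : Matrix (Fin d) (Fin d) ℝ)).PosDef ∧
    IsUnit (Aᵀ * A + α • (1 : Matrix (Fin d) (Fin d) ℝ)) ∧
    ∀ ystar xstar : EuclideanSpace ℝ (Fin d),
      ystar = (Aᵀ * A + α • (1 : Matrix (Fin d) (Fin d) ℝ))⁻¹.mulVec
        (fun i : Fin d => if (i : ℕ) = 0 then (1 : ℝ) else 0) →
      xstar = (fun i : Fin d => -(δ / (64 * μ)) * A.mulVec ystar i) →
      ((∀ y : EuclideanSpace ℝ (Fin d), f xstar y ≤ f xstar ystar) ∧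
       (∀ x : EuclideanSpace ℝ (Fin d), f xstar ystar ≤ f x ystar) ∧
       HasGradientAt (fun x : EuclideanSpace ℝ (Fin d) => f x ystar)
         (0 : EuclideanSpace ℝ (Fin d)) xstar ∧
       HasGradientAt (fun y : EuclideanSpace ℝ (Fin d) => f xstar y)
         (0 : EuclideanSpace ℝ (Fin d)) ystar) := by
  have hα : 0 < α := by rw [hαdef]; positivity
  have hpos := posDef_transpose_mul_self_add_smul_one A hα
  refine ⟨hpos, hpos.isUnit, ?_⟩
  intro y₀ x₀ hy hx
  have hM' : (0 : ℝ) < M := by exact_mod_cast hM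
  set c : ℝ := 16 * (p : ℝ) * μ / (M : ℝ) with hc
  have hc0 : 0 ≤ c := by positivity
  have hAy (i : Fin d) : ∑ j, A i j * y₀ j = -(64 * μ / δ) * x₀ i := by
    have h : x₀ i = -(δ / (64 * μ)) * ∑ j, A i j * y₀ j := congrFun hx i
    rw [h]
    field_simp
  have hsys (j : Fin d) :
      ∑ i, x₀ i * A i j = -(δ / (64 * μ)) * ((if (j : ℕ) = 0 then 1 else 0) - α * y₀ j) := by
    have h : (Aᵀ * A + α • (1 : Matrix (Fin d) (Fin d) ℝ)) *ᵥ y₀.ofLp =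
        fun i : Fin d => if (i : ℕ) = 0 then (1 : ℝ) else 0 := by
      rw [hy, mulVec_mulVec, mul_nonsing_inv _ ((isUnit_iff_isUnit_det _).mp hpos.isUnit),
        one_mulVec]
    have hj := congrFun h j
    rw [add_mulVec, smul_mulVec, one_mulVec, ← mulVec_mulVec] at hj
    have hT : (Aᵀ *ᵥ (A *ᵥ y₀.ofLp)) j = -(64 * μ / δ) * ∑ i, x₀ i * A i j := by
      rw [Finset.mul_sum, mulVec_eq_sum, Finset.sum_apply]
      refine Finset.sum_congr rfl fun i _ => ?_
      have hi : (A *ᵥ y₀.ofLp) i = -(64 * μ / δ) * x₀ i := hAy i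
      simp only [Pi.smul_apply, MulOpposite.smul_eq_mul_unop, MulOpposite.unop_op,
        transpose_transpose, hi]
      ring
    simp only [Pi.add_apply, Pi.smul_apply, smul_eq_mul, hT] at hj
    rw [← hj]
    field_simp
    ring
  have hfx (x : EuclideanSpace ℝ (Fin d)) : f x y₀ = f x₀ y₀ + c * ‖x - x₀‖ ^ 2 := by
    have hbil (x : EuclideanSpace ℝ (Fin d)) :
        ∑ i, ∑ j, x i * A i j * y₀ j = -(64 * μ / δ) * inner ℝ x x₀ := by
      simp only [mul_assoc, ← Finset.mul_sum, hAy, PiLp.inner_apply]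
      rw [Finset.mul_sum]
      refine Finset.sum_congr rfl fun i _ => ?_
      simp only [RCLike.inner_apply, conj_trivial]
      ring
    rw [hf, hf, hbil, hbil, norm_sub_sq_real, real_inner_self_eq_norm_sq, hc]
    field_simp
    ring
  have hfy (y : EuclideanSpace ℝ (Fin d)) : f x₀ y = f x₀ y₀ + -c * ‖y - y₀‖ ^ 2 := by
    have hbil (y : EuclideanSpace ℝ (Fin d)) :
        ∑ i, ∑ j, x₀ i * A i j * y j =
          -(δ / (64 * μ)) * (y ⟨0, hd⟩ - α * inner ℝ y y₀) := by
      have h0 : y ⟨0, hd⟩ = ∑ j : Fin d, (if (j : ℕ) = 0 then 1 else 0) * y j := by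
        rw [Finset.sum_eq_single ⟨0, hd⟩]
        · simp
        · intro j _ hj
          rw [if_neg fun h => hj (Fin.ext h), zero_mul]
        · simp
      rw [Finset.sum_comm, h0, PiLp.inner_apply, Finset.mul_sum, ← Finset.sum_sub_distrib,
        Finset.mul_sum]
      refine Finset.sum_congr rfl fun j _ => ?_
      rw [← Finset.sum_mul, hsys]
      simp only [RCLike.inner_apply, conj_trivial]
      ring
    rw [hf, hf, hbil, hbil, norm_sub_sq_real, real_inner_self_eq_norm_sq, hc, hαdef]
    field_simp
    ring
  refine ⟨fun y => ?_, fun x => ?_, hasGradientAt_zero_of_eq_add_mul_norm_sub_sq hfx,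
    hasGradientAt_zero_of_eq_add_mul_norm_sub_sq hfy⟩
  · rw [hfy y]
    nlinarith [mul_nonneg hc0 (sq_nonneg ‖y - y₀‖)]
  · rw [hfx x]
    nlinarith [mul_nonneg hc0 (sq_nonneg ‖x - x₀‖)]
end

section
/- Let H be a real inner product space, Z ⊆ H a nonempty convex set, μ > 0, δ ≥ 0, γ > 0, and F, F₁ : H → H maps such that: ⟨F z₁ − F z₂, z₁ − z₂⟩ ≥ μ‖z₁ − z₂‖² for all z₁, z₂ ∈ Z (F is μ-strongly monotone on Z); ‖(F z₁ − F₁ z₁) − (F z₂ − F₁ z₂)‖ ≤ δ‖z₁ − z₂‖ for all z₁, z₂ ∈ H (F − F₁ is δ-Lipschitz); and z* ∈ Z satisfies ⟨F z*, ζ − z*⟩ ≥ 0 for all ζ ∈ Z. Let z ∈ Z, set v = z − γ(F z − F₁ z), let û ∈ Z satisfy ⟨γ F₁ û + û − v, û − ζ⟩ ≤ 0 for all ζ ∈ Z, let u ∈ H, set w = u + γ(F z − F₁ z − F u + F₁ u), and let z⁺ ∈ Z satisfy ⟨w − z⁺, ζ − z⁺⟩ ≤ 0 for all ζ ∈ Z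 (z⁺ is the projection of w onto Z). Then ‖z⁺ − z*‖² ≤ (1 − γμ)‖z − z*‖² − (1 − 3γμ − 4γ²δ²)‖z − û‖² + (2 + 4γδ²/μ + 4/(γμ) + 4γ²δ²)‖u − û‖². -/
open RealInnerProductSpace

/-- Weighted Young inequality for a real inner product. -/
theorem two_mul_inner_le_weighted {H : Type*} [NormedAddCommGroup H] [InnerProductSpace ℝ H]
    {ε : ℝ} (hε : 0 < ε) (x y : H) : 2 * ⟪x, y⟫ ≤ ‖x‖ ^ 2 / ε + ε * ‖y‖ ^ 2 := by
  have hnonneg : 0 ≤ (‖x‖ - ε * ‖y‖) ^ 2 / ε := by positivity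
  have hsq : (‖x‖ - ε * ‖y‖) ^ 2 / ε = ‖x‖ ^ 2 / ε + ε * ‖y‖ ^ 2 - 2 * (‖x‖ * ‖y‖) := by
    field_simp
    ring
  linarith [real_inner_le_norm x y]

/-- Weighted bound for the squared norm of a sum. -/
theorem norm_add_sq_le_weighted {H : Type*} [NormedAddCommGroup H] [InnerProductSpace ℝ H]
    {ε : ℝ} (hε : 0 < ε) (x y : H) :
    ‖x + y‖ ^ 2 ≤ (1 + 1 / ε) * ‖x‖ ^ 2 + (1 + ε) * ‖y‖ ^ 2 := by
  have h := two_mul_inner_le_weighted hε x y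
  rw [norm_add_sq_real]
  linarith [show (1 + 1 / ε) * ‖x‖ ^ 2 = ‖x‖ ^ 2 + ‖x‖ ^ 2 / ε by ring]

/-- The variational characterization of a projection makes it contract distances to the set. -/
theorem norm_sub_sq_le_of_inner_le_zero {H : Type*} [NormedAddCommGroup H]
    [InnerProductSpace ℝ H] {w p s : H} (h : ⟪w - p, s - p⟫ ≤ 0) :
    ‖p - s‖ ^ 2 ≤ ‖w - s‖ ^ 2 := by
  have hexp := norm_sub_sq_real (w - p) (s - p)
  rw [sub_sub_sub_cancel_right, norm_sub_rev s p] at hexp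
  linarith [sq_nonneg ‖w - p‖]

/-- Lemma 4 of the paper: the one-iteration estimate for the centralized
Star Min-Max Data Similarity Algorithm. -/
theorem stmt_9 {H : Type*} [NormedAddCommGroup H] [InnerProductSpace ℝ H]
    (Z : Set H) (hZne : Z.Nonempty) (hZconv : Convex ℝ Z)
    (μ δ γ : ℝ) (hμ : 0 < μ) (hδ : 0 ≤ δ) (hγ : 0 < γ)
    (F F₁ : H → H)
    (hmono : ∀ z₁ ∈ Z, ∀ z₂ ∈ Z, μ * ‖z₁ - z₂‖ ^ 2 ≤ ⟪F z₁ - F z₂, z₁ - z₂⟫)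
    (hlip : ∀ z₁ z₂ : H, ‖(F z₁ - F₁ z₁) - (F z₂ - F₁ z₂)‖ ≤ δ * ‖z₁ - z₂‖)
    (zstar : H) (hzstarZ : zstar ∈ Z)
    (hopt : ∀ ζ ∈ Z, 0 ≤ ⟪F zstar, ζ - zstar⟫)
    (z : H) (hzZ : z ∈ Z)
    (v : H) (hv : v = z - γ • (F z - F₁ z))
    (uhat : H) (huhatZ : uhat ∈ Z)
    (huhat : ∀ ζ ∈ Z, ⟪γ • F₁ uhat + uhat - v, uhat - ζ⟫ ≤ 0)
    (u : H)
    (w : H) (hw : w = u + γ • (F z - F₁ z - F u + F₁ u))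
    (zplus : H) (hzplusZ : zplus ∈ Z)
    (hproj : ∀ ζ ∈ Z, ⟪w - zplus, ζ - zplus⟫ ≤ 0) :
    ‖zplus - zstar‖ ^ 2 ≤ (1 - γ * μ) * ‖z - zstar‖ ^ 2
      - (1 - 3 * γ * μ - 4 * γ ^ 2 * δ ^ 2) * ‖z - uhat‖ ^ 2
      + (2 + 4 * γ * δ ^ 2 / μ + 4 / (γ * μ) + 4 * γ ^ 2 * δ ^ 2) * ‖u - uhat‖ ^ 2 := by
  have hcontract := norm_sub_sq_le_of_inner_le_zero (hproj zstar hzstarZ)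
  have hsplit : ‖w - zstar‖ ^ 2 = ‖z - zstar‖ ^ 2 + 2 * ⟪w - z, uhat - zstar⟫
      + ‖w - uhat‖ ^ 2 - ‖z - uhat‖ ^ 2 := by
    simp only [← real_inner_self_eq_norm_sq, inner_sub_left, inner_sub_right]
    rw [real_inner_comm w zstar, real_inner_comm w uhat, real_inner_comm z zstar,
      real_inner_comm z uhat]
    ring
  have hmonotone : μ * ‖uhat - zstar‖ ^ 2 ≤ ⟪F uhat, uhat - zstar⟫ := by
    have h := hmono uhat huhatZ zstar hzstarZ
    rw [inner_sub_left] at h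
    linarith [hopt uhat huhatZ]
  set q := (F uhat - F₁ uhat) - (F u - F₁ u) with hq
  have hcross : ⟪w - z, uhat - zstar⟫ ≤ ⟪u - uhat, uhat - zstar⟫
      + γ * ⟪q, uhat - zstar⟫ - γ * (μ * ‖uhat - zstar‖ ^ 2) := by
    have hdecomp : w - z = (γ • F₁ uhat + uhat - v) + (u - uhat) + γ • q - γ • F uhat := by
      rw [hw, hv, hq]
      module
    rw [hdecomp, inner_sub_left, inner_add_left, inner_add_left, real_inner_smul_left,
      real_inner_smul_left]
    linarith [huhat zstar hzstarZ, mul_le_mul_of_nonneg_left hmonotone hγ.le]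
  have hyoung_u := two_mul_inner_le_weighted (show 0 < γ * μ / 4 by positivity)
    (u - uhat) (uhat - zstar)
  have hyoung_q := mul_le_mul_of_nonneg_left
    (two_mul_inner_le_weighted (show 0 < μ / 4 by positivity) q (uhat - zstar)) hγ.le
  have hq_bound : ‖q‖ ^ 2 ≤ δ ^ 2 * ‖u - uhat‖ ^ 2 := by
    rw [← mul_pow, norm_sub_rev u uhat]
    exact pow_le_pow_left₀ (norm_nonneg _) (hlip uhat u) 2
  have hq_scaled : γ * (‖q‖ ^ 2 / (μ / 4)) ≤ 4 * γ * δ ^ 2 / μ * ‖u - uhat‖ ^ 2 := by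
    calc γ * (‖q‖ ^ 2 / (μ / 4)) ≤ γ * (δ ^ 2 * ‖u - uhat‖ ^ 2 / (μ / 4)) := by gcongr
      _ = 4 * γ * δ ^ 2 / μ * ‖u - uhat‖ ^ 2 := by field_simp
  have hu_scaled : ‖u - uhat‖ ^ 2 / (γ * μ / 4) = 4 / (γ * μ) * ‖u - uhat‖ ^ 2 := by
    field_simp
  have hw_bound : ‖w - uhat‖ ^ 2 ≤ 2 * ‖u - uhat‖ ^ 2
      + 4 * γ ^ 2 * δ ^ 2 * (‖z - uhat‖ ^ 2 + ‖u - uhat‖ ^ 2) := by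
    have hdecomp : w - uhat = (u - uhat) + γ • ((F z - F₁ z) - (F u - F₁ u)) := by
      rw [hw]
      module
    have hsum := norm_add_sq_le_weighted one_pos (u - uhat) (γ • ((F z - F₁ z) - (F u - F₁ u)))
    rw [← hdecomp, norm_smul, mul_pow, Real.norm_eq_abs, sq_abs] at hsum
    have hz := norm_add_sq_le_weighted one_pos (z - uhat) (uhat - u)
    rw [sub_add_sub_cancel, norm_sub_rev uhat u] at hz
    have hlip_sq := pow_le_pow_left₀ (norm_nonneg _) (hlip z u) 2
    rw [mul_pow] at hlip_sq
    linarith [mul_le_mul_of_nonneg_left hlip_sq (sq_nonneg γ),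
      mul_le_mul_of_nonneg_left hz (show 0 ≤ γ ^ 2 * δ ^ 2 by positivity)]
  have hdist := norm_add_sq_le_weighted two_pos (uhat - zstar) (z - uhat)
  rw [add_comm, sub_add_sub_cancel] at hdist
  linarith [mul_le_mul_of_nonneg_left hdist (show 0 ≤ γ * μ by positivity)]
end

section
/- Let H be a real inner product space, Z ⊆ H a nonempty convex set, μ > 0, δ > 0, and F, F₁ : H → H maps such that: ⟨F z₁ − F z₂, z₁ − z₂⟩ ≥ μ‖z₁ − z₂‖² for all z₁, z₂ ∈ Z; ‖(F z₁ − F₁ z₁) − (F z₂ − F₁ z₂)‖ ≤ δ‖z₁ − z₂‖ for all z₁, z₂ ∈ H; and z* ∈ Z satisfies ⟨F z*, ζ − z*⟩ ≥ 0 for all ζ ∈ Z. Set γ = min{1/(12μ), 1/(4δ)} and ẽ = 1/(2(2 + 4γδ²/μ + 4/(γμ) + 4γ²δ²)). Let z ∈ Z, v = z − γ(F z − F₁ z), let û ∈ Z satisfy ⟨γ F₁ û + û − v, û − ζ⟩ ≤ 0 for all ζ ∈ Z, let u ∈ H satisfy ‖u − û‖² ≤ ẽ·‖z − û‖², set w =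 u + γ(F z − F₁ z − F u + F₁ u), and let z⁺ ∈ Z satisfy ⟨w − z⁺, ζ − z⁺⟩ ≤ 0 for all ζ ∈ Z. Then ‖z⁺ − z*‖² ≤ (1 − γμ)‖z − z*‖². -/
open RealInnerProductSpace

section

variable {H : Type*} [NormedAddCommGroup H] [InnerProductSpace ℝ H]

/-- Moving to the projection does not increase the distance to a point of the set. -/
lemma norm_sub_sq_le_of_inner_nonpos {w x y : H} (h : ⟪w - x, y - x⟫ ≤ 0) :
    ‖x - y‖ ^ 2 ≤ ‖w - y‖ ^ 2 := by
  have h1 : w - y = (w - x) - (y - x) := by abel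
  rw [h1, norm_sub_rev x y, norm_sub_sq_real (w - x)]
  nlinarith [sq_nonneg ‖w - x‖]

/-- Distance estimate for the step taken with the exact subproblem solution `x`. Here `f` and `fs`
stand for the values of the operator at `x` and at the solution `s`, `f₁` for the value of its
approximation at `x`, and `gz` for the value at `z` of the operator minus its approximation. -/
lemma norm_exact_step_sq_le {γ μ δ : ℝ} {z x s f f₁ fs gz : H} (hγ : 0 ≤ γ)
    (hk : γ * δ ≤ 1 / 4)
    (hlip : ‖gz - (f - f₁)‖ ≤ δ * ‖z - x‖)
    (hmono : μ * ‖x - s‖ ^ 2 ≤ ⟪f - fs, x - s⟫) (hopt : 0 ≤ ⟪fs, x - s⟫)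
    (hx : ⟪γ • f₁ + x - (z - γ • gz), x - s⟫ ≤ 0) :
    ‖(x - s) + γ • (gz - (f - f₁))‖ ^ 2 ≤
      ‖z - s‖ ^ 2 - 15 / 16 * ‖z - x‖ ^ 2 - 2 * (γ * μ) * ‖x - s‖ ^ 2 := by
  have hz : z - s = (z - x) + (x - s) := by abel
  have hsplit : γ • f₁ + x - (z - γ • gz) =
      γ • (f - fs) + γ • fs + γ • (gz - (f - f₁)) - (z - x) := by module
  have hstep : ‖γ • (gz - (f - f₁))‖ ≤ 1 / 4 * ‖z - x‖ := by
    rw [norm_smul, Real.norm_of_nonneg hγ]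
    nlinarith [mul_le_mul_of_nonneg_left hlip hγ, norm_nonneg (z - x)]
  have hsq : ‖γ • (gz - (f - f₁))‖ ^ 2 ≤ (1 / 4 * ‖z - x‖) ^ 2 := by gcongr
  rw [hsplit, inner_sub_left, inner_add_left, inner_add_left, real_inner_smul_left (f - fs),
    real_inner_smul_left fs] at hx
  rw [hz, norm_add_sq_real, norm_add_sq_real, real_inner_comm]
  nlinarith [mul_le_mul_of_nonneg_left hmono hγ, mul_nonneg hγ hopt]

end

/-- Per-iteration contraction in Theorem 5 of the paper: with stepsize
`γ = min{1/(12μ), 1/(4δ)}` and relative subproblem accuracy `ẽ`, each iteration of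
the centralized algorithm contracts the distance to the saddle point by `1 − γμ`. -/
theorem stmt_10 {H : Type*} [NormedAddCommGroup H] [InnerProductSpace ℝ H]
    (Z : Set H) (hZne : Z.Nonempty) (hZconv : Convex ℝ Z)
    (μ δ : ℝ) (hμ : 0 < μ) (hδ : 0 < δ)
    (F F₁ : H → H)
    (hmono : ∀ z₁ ∈ Z, ∀ z₂ ∈ Z, μ * ‖z₁ - z₂‖ ^ 2 ≤ ⟪F z₁ - F z₂, z₁ - z₂⟫)
    (hlip : ∀ z₁ z₂ : H, ‖(F z₁ - F₁ z₁) - (F z₂ - F₁ z₂)‖ ≤ δ * ‖z₁ - z₂‖)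
    (zstar : H) (hzstarZ : zstar ∈ Z)
    (hopt : ∀ ζ ∈ Z, 0 ≤ ⟪F zstar, ζ - zstar⟫)
    (γ etil : ℝ) (hγ : γ = min (1 / (12 * μ)) (1 / (4 * δ)))
    (hetil : etil = 1 / (2 * (2 + 4 * γ * δ ^ 2 / μ + 4 / (γ * μ) + 4 * γ ^ 2 * δ ^ 2)))
    (z : H) (hzZ : z ∈ Z)
    (v : H) (hv : v = z - γ • (F z - F₁ z))
    (uhat : H) (huhatZ : uhat ∈ Z)
    (huhat : ∀ ζ ∈ Z, ⟪γ • F₁ uhat + uhat - v, uhat - ζ⟫ ≤ 0)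
    (u : H) (hu : ‖u - uhat‖ ^ 2 ≤ etil * ‖z - uhat‖ ^ 2)
    (w : H) (hw : w = u + γ • (F z - F₁ z - F u + F₁ u))
    (zplus : H) (hzplusZ : zplus ∈ Z)
    (hproj : ∀ ζ ∈ Z, ⟪w - zplus, ζ - zplus⟫ ≤ 0) :
    ‖zplus - zstar‖ ^ 2 ≤ (1 - γ * μ) * ‖z - zstar‖ ^ 2 := by
  have hγpos : 0 < γ := by rw [hγ]; positivity
  have hm : γ * μ ≤ 1 / 12 := by
    have h : γ ≤ 1 / (12 * μ) := hγ ▸ min_le_left _ _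
    rw [le_div_iff₀ (by positivity)] at h
    linarith
  have hk : γ * δ ≤ 1 / 4 := by
    have h : γ ≤ 1 / (4 * δ) := hγ ▸ min_le_right _ _
    rw [le_div_iff₀ (by positivity)] at h
    linarith
  have hm0 : 0 < γ * μ := by positivity
  have he : etil ≤ γ * μ / 8 := by
    have h : 8 / (γ * μ) ≤
        2 * (2 + 4 * γ * δ ^ 2 / μ + 4 / (γ * μ) + 4 * γ ^ 2 * δ ^ 2) := by
      have h1 : 0 ≤ 4 * γ * δ ^ 2 / μ := by positivity
      have h2 : 0 ≤ 4 * γ ^ 2 * δ ^ 2 := by positivity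
      have h3 : 8 / (γ * μ) = 2 * (4 / (γ * μ)) := by ring
      linarith
    calc etil ≤ 1 / (8 / (γ * μ)) :=
          hetil ▸ one_div_le_one_div_of_le (by positivity) h
      _ = γ * μ / 8 := one_div_div _ _
  -- `p` is the exact extragradient step relative to `zstar`, `r` the inexactness error.
  obtain ⟨p, hp⟩ : ∃ p, p = (uhat - zstar) + γ • ((F z - F₁ z) - (F uhat - F₁ uhat)) :=
    ⟨_, rfl⟩
  obtain ⟨r, hr⟩ : ∃ r, r = (u - uhat) + γ • ((F uhat - F₁ uhat) - (F u - F₁ u)) :=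
    ⟨_, rfl⟩
  have hwpr : w - zstar = p + r := by
    rw [hw, hp, hr]
    module
  have hp2 : ‖p‖ ^ 2 ≤ ‖z - zstar‖ ^ 2 - 15 / 16 * ‖z - uhat‖ ^ 2
      - 2 * (γ * μ) * ‖uhat - zstar‖ ^ 2 := by
    rw [hp]
    exact norm_exact_step_sq_le hγpos.le hk (hlip z uhat)
      (hmono uhat huhatZ zstar hzstarZ) (hopt uhat huhatZ) (by simpa [hv] using huhat zstar hzstarZ)
  have hr2 : ‖r‖ ^ 2 ≤ 25 / 128 * (γ * μ) * ‖z - uhat‖ ^ 2 := by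
    have h1 : ‖r‖ ≤ 5 / 4 * ‖u - uhat‖ := by
      have h2 := hlip uhat u
      rw [norm_sub_rev uhat u] at h2
      calc ‖r‖ ≤ ‖u - uhat‖ + γ * ‖(F uhat - F₁ uhat) - (F u - F₁ u)‖ := by
            rw [hr]
            refine (norm_add_le _ _).trans_eq ?_
            rw [norm_smul, Real.norm_of_nonneg hγpos.le]
        _ ≤ ‖u - uhat‖ + γ * (δ * ‖u - uhat‖) := by gcongr
        _ ≤ 5 / 4 * ‖u - uhat‖ := by nlinarith [norm_nonneg (u - uhat)]
    have h3 : ‖r‖ ^ 2 ≤ (5 / 4 * ‖u - uhat‖) ^ 2 := by gcongr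
    have h4 : etil * ‖z - uhat‖ ^ 2 ≤ γ * μ / 8 * ‖z - uhat‖ ^ 2 := by gcongr
    nlinarith
  have hpr : ⟪p, r⟫ ≤ γ * μ / 4 * ‖p‖ ^ 2 + 25 / 128 * ‖z - uhat‖ ^ 2 := by
    have h := sq_nonneg ‖(γ * μ / 2) • p - r‖
    rw [norm_sub_sq_real, norm_smul, real_inner_smul_left, mul_pow,
      Real.norm_of_nonneg (by positivity)] at h
    refine le_of_mul_le_mul_left ?_ hm0
    nlinarith
  have hza : ‖z - zstar‖ ^ 2 ≤ 4 * ‖z - uhat‖ ^ 2 + 4 / 3 * ‖uhat - zstar‖ ^ 2 := by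
    have h1 : ‖z - zstar‖ ≤ ‖z - uhat‖ + ‖uhat - zstar‖ := norm_sub_le_norm_sub_add_norm_sub ..
    have h2 : ‖z - zstar‖ ^ 2 ≤ (‖z - uhat‖ + ‖uhat - zstar‖) ^ 2 := by gcongr
    nlinarith [sq_nonneg (3 * ‖z - uhat‖ - ‖uhat - zstar‖)]
  have hw2 : ‖w - zstar‖ ^ 2 = ‖p‖ ^ 2 + 2 * ⟪p, r⟫ + ‖r‖ ^ 2 := by
    rw [hwpr, norm_add_sq_real]
  have hplus := norm_sub_sq_le_of_inner_nonpos (hproj zstar hzstarZ)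
  have hd := sq_nonneg ‖z - uhat‖
  have hb := sq_nonneg ‖uhat - zstar‖
  generalize ‖z - uhat‖ ^ 2 = d at *
  generalize ‖uhat - zstar‖ ^ 2 = b at *
  generalize ‖z - zstar‖ ^ 2 = a at *
  generalize γ * μ = m at *
  have h1 : (1 + m / 2) * ‖p‖ ^ 2 ≤ (1 + m / 2) * (a - 15 / 16 * d - 2 * m * b) := by gcongr
  have h2 : m * a ≤ m * (4 * d + 4 / 3 * b) := by gcongr
  have h3 : m * d ≤ 1 / 12 * d := by gcongr
  have h4 : 0 ≤ m * d := by positivity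
  have h5 : 0 ≤ m * m * b := by positivity
  linarith
end

section
/- Let H be a real inner product space and Z ⊆ H a nonempty convex set of diameter at most Ω (i.e. ‖a − b‖ ≤ Ω for all a, b ∈ Z). Let L, G ≥ 0, δ ≥ 0, γ > 0, and F, F₁ : H → H maps such that: ‖F z₁ − F z₂‖ ≤ L‖z₁ − z₂‖ and ‖F₁ z₁ − F₁ z₂‖ ≤ L‖z₁ − z₂‖ for all z₁, z₂ ∈ Z; ‖(F z₁ − F₁ z₁) − (F z₂ − F₁ z₂)‖ ≤ δ‖z₁ − z₂‖ for all z₁, z₂ ∈ Z; and there is z* ∈ Z with ‖F z*‖ ≤ G and ‖F₁ z*‖ ≤ G. Let z ∈ Z, v = z − γ(F z − F₁ z), let û ∈ Z satisfy ⟨γ F₁ û + û − v, û − ζ⟩ ≤ 0 for all ζ ∈ Z, let u ∈ Z, set w = u + γ(F z − F₁ z − F u + F₁ u), and let z⁺ ∈ Z satisfy ⟨w − z⁺, ζ − z⁺⟩ ≤ 0 for all ζ ∈ Z. Then for every z' ∈ Z: 2γ⟨F u, u − z'⟩ ≤ ‖z − z'‖² − ‖z⁺ − z'‖² − (1 − 2γ²δ²)‖z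 − u‖² + (8γLΩ + 6γG + 2Ω)‖u − û‖ + 2‖u − û‖². -/
open RealInnerProductSpace

/-- If `⟪p + q, p⟫ ≤ 0` then `p + q` is no longer than `q`. -/
theorem norm_add_le_of_inner_add_left_nonpos {H : Type*} [NormedAddCommGroup H]
    [InnerProductSpace ℝ H] {p q : H} (h : ⟪p + q, p⟫ ≤ 0) : ‖p + q‖ ≤ ‖q‖ := by
  have hq : ‖q‖ ^ 2 = ‖p + q‖ ^ 2 - 2 * ⟪p + q, p⟫ + ‖p‖ ^ 2 := by
    rw [← norm_sub_sq_real, add_sub_cancel_left]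
  exact le_of_sq_le_sq (by nlinarith [sq_nonneg ‖p‖]) (norm_nonneg q)

/-- The obtuse-angle characterization of a projection, in terms of distances from `u` and `z`. -/
theorem projection_three_point {H : Type*} [NormedAddCommGroup H]
    [InnerProductSpace ℝ H] {z u d zplus z' : H}
    (h : ⟪u + d - zplus, z' - zplus⟫ ≤ 0) :
    ‖zplus - z'‖ ^ 2 ≤
      ‖z - z'‖ ^ 2 - ‖z - u‖ ^ 2 + 2 * ⟪u - z + d, u - z'⟫ + ‖d‖ ^ 2 := by
  have h₁ : ‖u + d - z'‖ ^ 2 = ‖u + d - zplus‖ ^ 2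
      - 2 * ⟪u + d - zplus, z' - zplus⟫ + ‖z' - zplus‖ ^ 2 := by
    rw [← norm_sub_sq_real, sub_sub_sub_cancel_right]
  have h₂ : ‖u + d - z'‖ ^ 2 = ‖u - z'‖ ^ 2 + 2 * ⟪u - z', d⟫ + ‖d‖ ^ 2 := by
    rw [← norm_add_sq_real]; congr 2; abel
  have h₃ : ‖z - z'‖ ^ 2 = ‖z - u‖ ^ 2 + 2 * ⟪z - u, u - z'⟫ + ‖u - z'‖ ^ 2 := by
    rw [← norm_add_sq_real, sub_add_sub_cancel]
  have h₄ : ⟪u - z + d, u - z'⟫ = -⟪z - u, u - z'⟫ + ⟪u - z', d⟫ := by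
    rw [inner_add_left, ← neg_sub z u, inner_neg_left, real_inner_comm d]
  rw [norm_sub_rev zplus z']
  nlinarith [sq_nonneg ‖u + d - zplus‖]

/-- Per-iteration estimate for the centralized algorithm in the merely
convex-concave case (the convex-concave Lemma in the paper's appendix). -/
theorem stmt_12 {H : Type*} [NormedAddCommGroup H] [InnerProductSpace ℝ H]
    (Z : Set H) (hZne : Z.Nonempty) (hZconv : Convex ℝ Z)
    (Ω : ℝ) (hdiam : ∀ a ∈ Z, ∀ b ∈ Z, ‖a - b‖ ≤ Ω)
    (L G δ γ : ℝ) (hL : 0 ≤ L) (hG : 0 ≤ G) (hδ : 0 ≤ δ) (hγ : 0 < γ)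
    (F F₁ : H → H)
    (hFlip : ∀ z₁ ∈ Z, ∀ z₂ ∈ Z, ‖F z₁ - F z₂‖ ≤ L * ‖z₁ - z₂‖)
    (hF₁lip : ∀ z₁ ∈ Z, ∀ z₂ ∈ Z, ‖F₁ z₁ - F₁ z₂‖ ≤ L * ‖z₁ - z₂‖)
    (hrel : ∀ z₁ ∈ Z, ∀ z₂ ∈ Z, ‖(F z₁ - F₁ z₁) - (F z₂ - F₁ z₂)‖ ≤ δ * ‖z₁ - z₂‖)
    (zstar : H) (hzstarZ : zstar ∈ Z) (hFG : ‖F zstar‖ ≤ G) (hF₁G : ‖F₁ zstar‖ ≤ G)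
    (z : H) (hzZ : z ∈ Z)
    (v : H) (hv : v = z - γ • (F z - F₁ z))
    (uhat : H) (huhatZ : uhat ∈ Z)
    (huhat : ∀ ζ ∈ Z, ⟪γ • F₁ uhat + uhat - v, uhat - ζ⟫ ≤ 0)
    (u : H) (huZ : u ∈ Z)
    (w : H) (hw : w = u + γ • (F z - F₁ z - F u + F₁ u))
    (zplus : H) (hzplusZ : zplus ∈ Z)
    (hproj : ∀ ζ ∈ Z, ⟪w - zplus, ζ - zplus⟫ ≤ 0) :
    ∀ z' ∈ Z,
      2 * γ * ⟪F u, u - z'⟫ ≤ ‖z - z'‖ ^ 2 - ‖zplus - z'‖ ^ 2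
        - (1 - 2 * γ ^ 2 * δ ^ 2) * ‖z - u‖ ^ 2
        + (8 * γ * L * Ω + 6 * γ * G + 2 * Ω) * ‖u - uhat‖
        + 2 * ‖u - uhat‖ ^ 2 := by
  intro z' hz'
  subst hv hw
  have hΩ : 0 ≤ Ω := (norm_nonneg _).trans (hdiam z hzZ z hzZ)
  set q : H := γ • (F z + (F₁ uhat - F₁ z)) with hq
  set d : H := γ • (F z - F₁ z - F u + F₁ u) with hd
  have hAhat : γ • F₁ uhat + uhat - (z - γ • (F z - F₁ z)) = (uhat - z) + q := by
    rw [hq]; module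
  rw [hAhat] at huhat
  have hFz : ‖F z‖ ≤ G + L * Ω := by
    have h₁ := norm_le_norm_add_norm_sub' (F z) (F zstar)
    have h₂ := hFlip z hzZ zstar hzstarZ
    have h₃ := mul_le_mul_of_nonneg_left (hdiam z hzZ zstar hzstarZ) hL
    linarith
  have hF₁diff : ‖F₁ uhat - F₁ z‖ ≤ L * Ω :=
    (hF₁lip uhat huhatZ z hzZ).trans
      (mul_le_mul_of_nonneg_left (hdiam uhat huhatZ z hzZ) hL)
  have hqnorm : ‖q‖ ≤ γ * (G + 2 * (L * Ω)) := by
    rw [hq, norm_smul, Real.norm_of_nonneg hγ.le]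
    refine mul_le_mul_of_nonneg_left ?_ hγ.le
    linarith [norm_add_le (F z) (F₁ uhat - F₁ z)]
  have hAnorm : ‖(uhat - z) + q‖ ≤ γ * (G + 2 * (L * Ω)) :=
    (norm_add_le_of_inner_add_left_nonpos (huhat z hzZ)).trans hqnorm
  have hdnorm : ‖d‖ ≤ γ * (δ * ‖z - u‖) := by
    rw [hd, norm_smul, Real.norm_of_nonneg hγ.le]
    refine mul_le_mul_of_nonneg_left ?_ hγ.le
    rw [sub_add]
    exact hrel z hzZ u huZ
  have hdsq : ‖d‖ ^ 2 ≤ γ ^ 2 * δ ^ 2 * ‖z - u‖ ^ 2 :=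
    (pow_le_pow_left₀ (norm_nonneg d) hdnorm 2).trans_eq (by ring)
  have hsplit : ⟪u - z + d, u - z'⟫ + γ * ⟪F u, u - z'⟫ =
      ⟪(uhat - z) + q, uhat - z'⟫ + ⟪(uhat - z) + q, u - uhat⟫
        + ⟪(u - uhat) + γ • (F₁ u - F₁ uhat), u - z'⟫ := by
    rw [← inner_add_right, ← real_inner_smul_left, ← inner_add_left, add_comm (uhat - z'),
      sub_add_sub_cancel, ← inner_add_left]
    congr 1
    rw [hd, hq]; module
  have herr₁ : ⟪(uhat - z) + q, u - uhat⟫ ≤ γ * (G + 2 * (L * Ω)) * ‖u - uhat‖ :=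
    (real_inner_le_norm _ _).trans (mul_le_mul_of_nonneg_right hAnorm (norm_nonneg _))
  have herr₂ : ⟪(u - uhat) + γ • (F₁ u - F₁ uhat), u - z'⟫
      ≤ (‖u - uhat‖ + γ * (L * ‖u - uhat‖)) * Ω := by
    refine (real_inner_le_norm _ _).trans
      (mul_le_mul ?_ (hdiam u huZ z' hz') (norm_nonneg _) (by positivity))
    refine (norm_add_le _ _).trans (add_le_add_right ?_ _)
    rw [norm_smul, Real.norm_of_nonneg hγ.le]
    exact mul_le_mul_of_nonneg_left (hF₁lip u huZ uhat huhatZ) hγ.le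
  have hthree := projection_three_point (z := z) (hproj z' hz')
  have hopt := huhat z' hz'
  have hslack₁ : 0 ≤ γ * L * Ω * ‖u - uhat‖ := by positivity
  have hslack₂ : 0 ≤ γ * G * ‖u - uhat‖ := by positivity
  have hslack₃ : 0 ≤ γ ^ 2 * δ ^ 2 * ‖z - u‖ ^ 2 := by positivity
  linarith [sq_nonneg ‖u - uhat‖]
end

section
/- Let H be a real inner product space, Z ⊆ H a nonempty convex set, μ > 0, δ ≥ 0, γ > 0, and F, F_m : H → H maps such that: ⟨F z₁ − F z₂, z₁ − z₂⟩ ≥ μ‖z₁ − z₂‖² for all z₁, z₂ ∈ Z; ‖(F z₁ − F_m z₁) − (F z₂ − F_m z₂)‖ ≤ δ‖z₁ − z₂‖ for all z₁, z₂ ∈ H; and z* ∈ Z satisfies ⟨F z*, ζ − z*⟩ ≥ 0 for all ζ ∈ Z. Let z ∈ H and ḡ, ḡ' ∈ H be arbitrary (approximate gradients); set v = z − γ(ḡ − F_m z); let û ∈ Z satisfy ⟨γ F_m û + û − v, û − ζ⟩ ≤ 0 for all ζ ∈ Z; let ũ ∈ H; set z̃⁺ = ũ + γ(ḡ − F_m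 z − ḡ' + F_m ũ); let ẑ⁺ ∈ H; and let z⁺ ∈ Z satisfy ⟨ẑ⁺ − z⁺, ζ − z⁺⟩ ≤ 0 for all ζ ∈ Z. Then ‖z⁺ − z*‖² ≤ (1 − γμ)‖z − z*‖² − (1 − 3γμ − 12γ²δ²)‖z − û‖² + (2 + 12γ²δ² + 4/(γμ) + 8γδ²/μ)‖ũ − û‖² + 6γ²‖ḡ − F z‖² + (6γ² + 8γ/μ)‖ḡ' − F ũ‖² + 2⟨ẑ⁺ − z̃⁺, z̃⁺ − z*⟩ + ‖z̃⁺ − ẑ⁺‖². -/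
open RealInnerProductSpace

lemma norm_add_add_sq_le_three_mul {E : Type*} [SeminormedAddCommGroup E] (x y w : E) :
    ‖x + y + w‖ ^ 2 ≤ 3 * ‖x‖ ^ 2 + 3 * ‖y‖ ^ 2 + 3 * ‖w‖ ^ 2 := by
  have h : ‖x + y + w‖ ^ 2 ≤ (‖x‖ + ‖y‖ + ‖w‖) ^ 2 := by
    gcongr
    exact norm_add₃_le
  nlinarith [sq_nonneg (‖x‖ - ‖y‖), sq_nonneg (‖y‖ - ‖w‖), sq_nonneg (‖x‖ - ‖w‖)]

section InnerProductEstimates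

variable {H : Type*} [NormedAddCommGroup H] [InnerProductSpace ℝ H]

/-- Young's inequality for the inner product. -/
lemma two_mul_inner_le_mul_sq_add_div (x y : H) {c : ℝ} (hc : 0 < c) :
    2 * ⟪x, y⟫ ≤ c * ‖x‖ ^ 2 + ‖y‖ ^ 2 / c := by
  have hsq : 0 ≤ ‖c • x - y‖ ^ 2 := sq_nonneg _
  rw [norm_sub_sq_real, norm_smul, real_inner_smul_left, mul_pow, Real.norm_eq_abs,
    sq_abs] at hsq
  have hmul : 2 * ⟪x, y⟫ * c ≤ (c * ‖x‖ ^ 2 + ‖y‖ ^ 2 / c) * c := by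
    rw [add_mul, div_mul_cancel₀ _ hc.ne']
    linarith
  exact le_of_mul_le_mul_right hmul hc

lemma norm_add_sq_le_of_young (x y : H) {c : ℝ} (hc : 0 < c) :
    ‖x + y‖ ^ 2 ≤ (1 + c) * ‖x‖ ^ 2 + (1 + 1 / c) * ‖y‖ ^ 2 := by
  have hyoung := two_mul_inner_le_mul_sq_add_div x y hc
  rw [norm_add_sq_real]
  calc _ ≤ ‖x‖ ^ 2 + (c * ‖x‖ ^ 2 + ‖y‖ ^ 2 / c) + ‖y‖ ^ 2 := by gcongr
    _ = _ := by ring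

lemma norm_add_sq_le_two_mul (x y : H) : ‖x + y‖ ^ 2 ≤ 2 * ‖x‖ ^ 2 + 2 * ‖y‖ ^ 2 := by
  have h := norm_add_sq_le_of_young x y one_pos
  norm_num at h
  exact h

/-- The variational characterization of the projection gives nonexpansiveness towards points of
the set. -/
lemma norm_sub_sq_le_of_inner_sub_nonpos {x p s : H} (h : ⟪x - p, s - p⟫ ≤ 0) :
    ‖p - s‖ ^ 2 ≤ ‖x - s‖ ^ 2 := by
  have hexp : ‖x - s‖ ^ 2 = ‖x - p‖ ^ 2 - 2 * ⟪x - p, s - p⟫ + ‖s - p‖ ^ 2 := by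
    rw [← norm_sub_sq_real, sub_sub_sub_cancel_right]
  rw [hexp, norm_sub_rev p s]
  linarith [sq_nonneg ‖x - p‖]

end InnerProductEstimates

/-- Lemma 7 of the paper's appendix: one-iteration estimate for the Distributed
Min-Max Data Similarity Algorithm, with consensus/gossip errors appearing as
explicit additive terms. -/
theorem stmt_15 {H : Type*} [NormedAddCommGroup H] [InnerProductSpace ℝ H]
    (Z : Set H) (hZne : Z.Nonempty) (hZconv : Convex ℝ Z)
    (μ δ γ : ℝ) (hμ : 0 < μ) (hδ : 0 ≤ δ) (hγ : 0 < γ)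
    (F Fm : H → H)
    (hmono : ∀ z₁ ∈ Z, ∀ z₂ ∈ Z, μ * ‖z₁ - z₂‖ ^ 2 ≤ ⟪F z₁ - F z₂, z₁ - z₂⟫)
    (hlip : ∀ z₁ z₂ : H, ‖(F z₁ - Fm z₁) - (F z₂ - Fm z₂)‖ ≤ δ * ‖z₁ - z₂‖)
    (zstar : H) (hzstarZ : zstar ∈ Z)
    (hopt : ∀ ζ ∈ Z, 0 ≤ ⟪F zstar, ζ - zstar⟫)
    (z gbar gbar' : H)
    (v : H) (hv : v = z - γ • (gbar - Fm z))
    (uhat : H) (huhatZ : uhat ∈ Z)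
    (huhat : ∀ ζ ∈ Z, ⟪γ • Fm uhat + uhat - v, uhat - ζ⟫ ≤ 0)
    (utilde : H)
    (ztilde : H) (hzt : ztilde = utilde + γ • (gbar - Fm z - gbar' + Fm utilde))
    (zhat : H)
    (zplus : H) (hzplusZ : zplus ∈ Z)
    (hproj : ∀ ζ ∈ Z, ⟪zhat - zplus, ζ - zplus⟫ ≤ 0) :
    ‖zplus - zstar‖ ^ 2 ≤ (1 - γ * μ) * ‖z - zstar‖ ^ 2
      - (1 - 3 * γ * μ - 12 * γ ^ 2 * δ ^ 2) * ‖z - uhat‖ ^ 2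
      + (2 + 12 * γ ^ 2 * δ ^ 2 + 4 / (γ * μ) + 8 * γ * δ ^ 2 / μ) * ‖utilde - uhat‖ ^ 2
      + 6 * γ ^ 2 * ‖gbar - F z‖ ^ 2
      + (6 * γ ^ 2 + 8 * γ / μ) * ‖gbar' - F utilde‖ ^ 2
      + 2 * ⟪zhat - ztilde, ztilde - zstar⟫
      + ‖ztilde - zhat‖ ^ 2 := by
  have hγμ : 0 < γ * μ := mul_pos hγ hμ
  have hproj_le : ‖zplus - zstar‖ ^ 2 ≤ ‖zhat - zstar‖ ^ 2 :=
    norm_sub_sq_le_of_inner_sub_nonpos (hproj zstar hzstarZ)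
  have hgossip : ‖zhat - zstar‖ ^ 2 = ‖ztilde - zstar‖ ^ 2
      + 2 * ⟪zhat - ztilde, ztilde - zstar⟫ + ‖ztilde - zhat‖ ^ 2 := by
    have h := norm_add_sq_real (zhat - ztilde) (ztilde - zstar)
    rw [sub_add_sub_cancel, norm_sub_rev zhat ztilde] at h
    linarith
  set r := uhat - zstar with hr
  set e := utilde - uhat with he
  set b := gbar' - F utilde with hb
  set d := (F utilde - Fm utilde) - (F uhat - Fm uhat) with hd
  set d' := (F z - Fm z) - (F utilde - Fm utilde) with hd'
  set q := ztilde - uhat with hq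
  have hd_le : ‖d‖ ^ 2 ≤ δ ^ 2 * ‖e‖ ^ 2 := by
    rw [← mul_pow]
    exact pow_le_pow_left₀ (norm_nonneg _) (hlip utilde uhat) 2
  have hd'_le : ‖d'‖ ^ 2 ≤ δ ^ 2 * (2 * ‖z - uhat‖ ^ 2 + 2 * ‖e‖ ^ 2) := by
    have hdist : ‖z - utilde‖ ^ 2 ≤ 2 * ‖z - uhat‖ ^ 2 + 2 * ‖e‖ ^ 2 := by
      have h := norm_add_sq_le_two_mul (z - uhat) (-e)
      rwa [norm_neg, he, neg_sub, sub_add_sub_cancel] at h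
    calc ‖d'‖ ^ 2 ≤ (δ * ‖z - utilde‖) ^ 2 :=
          pow_le_pow_left₀ (norm_nonneg _) (hlip z utilde) 2
      _ = δ ^ 2 * ‖z - utilde‖ ^ 2 := mul_pow _ _ _
      _ ≤ _ := by gcongr
  have hq_eq : q = e + γ • ((gbar - F z) + d' + -b) := by
    rw [hq, he, hb, hd', hzt]
    module
  have hq_le : ‖q‖ ^ 2 ≤ 2 * ‖e‖ ^ 2 + 6 * γ ^ 2 * ‖gbar - F z‖ ^ 2
      + 6 * γ ^ 2 * (δ ^ 2 * (2 * ‖z - uhat‖ ^ 2 + 2 * ‖e‖ ^ 2)) + 6 * γ ^ 2 * ‖b‖ ^ 2 := by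
    have hsum := norm_add_add_sq_le_three_mul (gbar - F z) d' (-b)
    rw [norm_neg] at hsum
    calc ‖q‖ ^ 2 ≤ 2 * ‖e‖ ^ 2 + 2 * ‖γ • ((gbar - F z) + d' + -b)‖ ^ 2 := by
          rw [hq_eq]
          exact norm_add_sq_le_two_mul _ _
      _ = 2 * ‖e‖ ^ 2 + 2 * (γ ^ 2 * ‖(gbar - F z) + d' + -b‖ ^ 2) := by
          rw [norm_smul, mul_pow, Real.norm_eq_abs, sq_abs]
      _ ≤ 2 * ‖e‖ ^ 2 + 2 * (γ ^ 2 * (3 * ‖gbar - F z‖ ^ 2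
            + 3 * (δ ^ 2 * (2 * ‖z - uhat‖ ^ 2 + 2 * ‖e‖ ^ 2)) + 3 * ‖b‖ ^ 2)) := by
          gcongr
          linarith
      _ = _ := by ring
  have hstrong : μ * ‖r‖ ^ 2 ≤ ⟪F uhat, r⟫ := by
    have hm := hmono uhat huhatZ zstar hzstarZ
    rw [inner_sub_left] at hm
    linarith [hopt uhat huhatZ]
  have hcross : ⟪uhat - z + q, r⟫ ≤
      ⟪e, r⟫ + γ * ⟪-b, r⟫ + γ * ⟪-d, r⟫ - γ * (μ * ‖r‖ ^ 2) := by
    have hdecomp : uhat - z + q = (γ • Fm uhat + uhat - v)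
        + (e + γ • -b + γ • -d - γ • F uhat) := by
      rw [hq_eq, hv, hb, hd, hd']
      module
    rw [hdecomp, inner_add_left, inner_sub_left (e + γ • -b + γ • -d), inner_add_left (e + γ • -b),
      inner_add_left e,
      real_inner_smul_left, real_inner_smul_left, real_inner_smul_left]
    have hstrong_mul := mul_le_mul_of_nonneg_left hstrong hγ.le
    linarith [huhat zstar hzstarZ]
  have hexpand : ‖ztilde - zstar‖ ^ 2 = ‖z - zstar‖ ^ 2 - ‖z - uhat‖ ^ 2
      + 2 * ⟪uhat - z + q, r⟫ + ‖q‖ ^ 2 := by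
    have hzt_sq := norm_add_sq_real q r
    have hz_sq := norm_add_sq_real (z - uhat) r
    rw [hq, hr, sub_add_sub_cancel, ← hq, ← hr] at hzt_sq
    rw [hr, sub_add_sub_cancel, ← hr, ← neg_sub uhat z, inner_neg_left, norm_neg,
      norm_sub_rev uhat z] at hz_sq
    rw [inner_add_left]
    linarith
  have hyoung_e : 2 * ⟪e, r⟫ ≤ 4 / (γ * μ) * ‖e‖ ^ 2 + γ * μ / 4 * ‖r‖ ^ 2 :=
    (two_mul_inner_le_mul_sq_add_div e r (by positivity : 0 < 4 / (γ * μ))).trans_eq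
      (by field_simp)
  have hyoung (x : H) :
      2 * (γ * ⟪-x, r⟫) ≤ 8 * γ / μ * ‖x‖ ^ 2 + γ * μ / 8 * ‖r‖ ^ 2 := by
    have h := two_mul_inner_le_mul_sq_add_div (-x) r (by positivity : 0 < 8 / μ)
    rw [norm_neg] at h
    calc 2 * (γ * ⟪-x, r⟫) = γ * (2 * ⟪-x, r⟫) := by ring
      _ ≤ γ * (8 / μ * ‖x‖ ^ 2 + ‖r‖ ^ 2 / (8 / μ)) := by gcongr
      _ = _ := by field_simp
  have hd_scaled : 8 * γ / μ * ‖d‖ ^ 2 ≤ 8 * γ * δ ^ 2 / μ * ‖e‖ ^ 2 :=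
    calc 8 * γ / μ * ‖d‖ ^ 2 ≤ 8 * γ / μ * (δ ^ 2 * ‖e‖ ^ 2) := by gcongr
      _ = _ := by ring
  have hdist_scaled : γ * μ * ‖z - zstar‖ ^ 2 ≤
      γ * μ * (3 * ‖z - uhat‖ ^ 2 + 3 / 2 * ‖r‖ ^ 2) := by
    have h := norm_add_sq_le_of_young (z - uhat) r two_pos
    rw [hr, sub_add_sub_cancel, ← hr] at h
    gcongr
    linarith
  linarith [hyoung b, hyoung d]
end
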